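/- Let 𝓑 be a bornology on ω such that the family {ω \ B : B ∈ 𝓑} is an ultrafilter on ω. Then the finitary 𝓑-macrocube — the subballean of the 𝓑-macrocube whose points are the finite subsets of ω — is not normal. -/

import Mathlib

open scoped symmDiff

/-- A bornology on `ℕ` (the set `ω`): a family of subsets containing all finite
subsets, closed under taking subsets and finite unions. -/
def IsBornology (𝓑 : Set (Set ℕ)) : Prop :=
  (∀ A : Set ℕ, A.Finite → A ∈ 𝓑) ∧
  (∀ A B : Set ℕ, A ∈ 𝓑 → B ⊆ A → B ∈ 𝓑) ∧
  (∀ A B : Set ℕ, A ∈ 𝓑 → B ∈ 𝓑 → A ∪ B ∈ 𝓑)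

/-- The carrier of the finitary `𝓑`-macrocube: the finite subsets of `ω`. -/
def finCube : Set (Set ℕ) := {A | A.Finite}

/-- `E_B[Y]` in the finitary `𝓑`-macrocube. -/
def fcE (B : Set ℕ) (Y : Set (Set ℕ)) : Set (Set ℕ) :=
  {A | A ∈ finCube ∧ ∃ A' ∈ Y, A ∆ A' ⊆ B}

/-- Boundedness of a subset of the finitary `𝓑`-macrocube. -/
def fcBounded (𝓑 : Set (Set ℕ)) (Y : Set (Set ℕ)) : Prop :=
  ∃ B ∈ 𝓑, ∀ A ∈ Y, ∀ A' ∈ Y, A ∆ A' ⊆ B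

/-- Asymptotic disjointness in the finitary `𝓑`-macrocube. -/
def fcAsympDisjoint (𝓑 : Set (Set ℕ)) (Y Z : Set (Set ℕ)) : Prop :=
  ∀ B ∈ 𝓑, fcBounded 𝓑 (fcE B Y ∩ fcE B Z)

/-- `U` is an asymptotic neighbourhood of `Y` in the finitary `𝓑`-macrocube. -/
def fcAsympNbhd (𝓑 : Set (Set ℕ)) (Y U : Set (Set ℕ)) : Prop :=
  ∀ B ∈ 𝓑, fcBounded 𝓑 (fcE B Y \ U)

/-- Normality of the finitary `𝓑`-macrocube. -/
def fcNormal (𝓑 : Set (Set ℕ)) : Prop :=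
  ∀ Y Z : Set (Set ℕ), Y ⊆ finCube → Z ⊆ finCube → fcAsympDisjoint 𝓑 Y Z →
    ∃ U V : Set (Set ℕ), fcAsympNbhd 𝓑 Y U ∧ fcAsympNbhd 𝓑 Z V ∧ Disjoint U V

/-- A bounded family of finite sets has its union in the bornology. -/
theorem fcBounded.exists_superset {𝓑 : Set (Set ℕ)} (hB : IsBornology 𝓑) {Y : Set (Set ℕ)}
    (hY : Y ⊆ finCube) (h : fcBounded 𝓑 Y) : ∃ B ∈ 𝓑, ∀ A ∈ Y, A ⊆ B := by
  obtain ⟨B, hBm, hb⟩ := h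
  rcases Y.eq_empty_or_nonempty with rfl | ⟨A₀, hA₀⟩
  · exact ⟨B, hBm, fun A hA => absurd hA (Set.notMem_empty A)⟩
  · refine ⟨B ∪ A₀, hB.2.2 _ _ hBm (hB.1 _ (hY hA₀)), fun A hA x hx => ?_⟩
    by_cases hx0 : x ∈ A₀
    · exact Or.inr hx0
    · exact Or.inl (hb A hA A₀ hA₀ (Or.inl ⟨hx, hx0⟩))

/-- The dual ideal of a nonprincipal ultrafilter is not countably generated. -/
theorem exists_not_subset_of_ultra {𝓑 : Set (Set ℕ)} (hB : IsBornology 𝓑)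
    (hunb : Set.univ ∉ 𝓑) (hultra : ∀ S : Set ℕ, S ∈ 𝓑 ∨ Sᶜ ∈ 𝓑) (G : ℕ → Set ℕ)
    (hG : ∀ n, G n ∈ 𝓑) : ∃ B ∈ 𝓑, ∀ n, ¬ B ⊆ G n := by
  have hinf : ∀ k, ∃ᶠ x in Filter.atTop, x ∉ G (k / 2) := by
    intro k
    refine Nat.frequently_atTop_iff_infinite.2 fun hfin => hunb ?_
    have := hB.2.2 _ _ (hG (k / 2)) (hB.1 _ hfin)
    rwa [show {n | n ∉ G (k / 2)} = (G (k / 2))ᶜ from rfl, Set.union_compl_self] at this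
  obtain ⟨x, hx, hxG⟩ := Filter.extraction_forall_of_frequently hinf
  rcases hultra (Set.range fun n => x (2 * n)) with h | h
  · refine ⟨_, h, fun n hn => hxG (2 * n) ?_⟩
    rw [show 2 * n / 2 = n by omega]
    exact hn ⟨n, rfl⟩
  · refine ⟨_, h, fun n hn => hxG (2 * n + 1) ?_⟩
    rw [show (2 * n + 1) / 2 = n by omega]
    refine hn ?_
    rintro ⟨m, hm⟩
    have := hx.injective hm
    omega

/-- Initial segments and singletons are asymptotically disjoint. -/
theorem fcAsympDisjoint_range_Iic_range_singleton {𝓑 : Set (Set ℕ)} (hB : IsBornology 𝓑)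
    (hunb : Set.univ ∉ 𝓑) :
    fcAsympDisjoint 𝓑 (Set.range fun n : ℕ => Set.Iic n) (Set.range fun m : ℕ => {m}) := by
  classical
  intro B hBm
  have hex : ∃ s, s ∉ B := (Set.ne_univ_iff_exists_notMem B).1 fun h => hunb (h ▸ hBm)
  have key : ∀ A ∈ fcE B (Set.range fun n : ℕ => Set.Iic n) ∩ fcE B (Set.range fun m : ℕ => {m}),
      A ⊆ B ∪ {Nat.find hex} := by
    rintro A ⟨⟨-, -, ⟨n, rfl⟩, hn⟩, -, -, ⟨m, rfl⟩, hm⟩ x hx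
    by_contra hxB
    simp only [Set.mem_union, Set.mem_singleton_iff, not_or] at hxB
    obtain ⟨hxB, hxs⟩ := hxB
    have hxn : x ≤ n := by
      by_contra h
      exact hxB (hn (Or.inl ⟨hx, h⟩))
    have eq_m : ∀ y ∈ A, y ∉ B → y = m := fun y hy hyB => by
      by_contra h
      exact hyB (hm (Or.inl ⟨hy, h⟩))
    have hsA : Nat.find hex ∈ A := by
      by_contra h
      exact Nat.find_spec hex (hn (Or.inr ⟨(Nat.find_min' hex hxB).trans hxn, h⟩))
    exact hxs ((eq_m x hx hxB).trans (eq_m _ hsA (Nat.find_spec hex)).symm)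
  refine ⟨B ∪ {Nat.find hex}, hB.2.2 _ _ hBm (hB.1 _ (Set.finite_singleton _)), ?_⟩
  rintro A hA A' hA' x (⟨hx, -⟩ | ⟨hx, -⟩)
  exacts [key A hA hx, key A' hA' hx]

/-- If `{ω \ B : B ∈ 𝓑}` is an ultrafilter on `ω`, then the finitary
`𝓑`-macrocube is not normal. -/
theorem finitary_macrocube_not_normal_of_ultrafilter
    (𝓑 : Set (Set ℕ)) (hB : IsBornology 𝓑) (hunb : Set.univ ∉ 𝓑)
    (hultra : ∀ S : Set ℕ, S ∈ 𝓑 ∨ Sᶜ ∈ 𝓑) :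
    ¬ fcNormal 𝓑 := by
  intro hnorm
  obtain ⟨U, V, hU, hV, hUV⟩ := hnorm (Set.range fun n : ℕ => Set.Iic n)
    (Set.range fun m : ℕ => {m}) (by rintro _ ⟨n, rfl⟩; exact Set.finite_Iic n)
    (by rintro _ ⟨m, rfl⟩; exact Set.finite_singleton m)
    (fcAsympDisjoint_range_Iic_range_singleton hB hunb)
  have hV' : ∀ n : ℕ, ∃ G ∈ 𝓑, ∀ A ∈ fcE (Set.Iic n) (Set.range fun m : ℕ => {m}) \ V, A ⊆ G :=
    fun n => fcBounded.exists_superset hB (fun A hA => hA.1.1) (hV _ (hB.1 _ (Set.finite_Iic n)))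
  choose G hG hGV using hV'
  obtain ⟨B, hBm, hBG⟩ := exists_not_subset_of_ultra hB hunb hultra G hG
  obtain ⟨F, hF, hFU⟩ := fcBounded.exists_superset hB (fun A hA => hA.1.1) (hU B hBm)
  obtain ⟨n, hn⟩ : ∃ n, n ∉ F ∪ B :=
    (Set.ne_univ_iff_exists_notMem _).1 fun h => hunb (h ▸ hB.2.2 _ _ hF hBm)
  obtain ⟨hnF, hnB⟩ := not_or.1 hn
  refine hBG n fun m hm => ?_
  have hfin : insert m (Set.Iic n \ B) ∈ finCube := (Set.finite_Iic n).sdiff.insert m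
  have hAU : insert m (Set.Iic n \ B) ∈ U := by
    by_contra h
    refine hnF (hFU _ ⟨⟨hfin, _, ⟨n, rfl⟩, ?_⟩, h⟩ (Or.inr ⟨le_refl n, hnB⟩))
    rintro x (⟨rfl | hx, hx'⟩ | ⟨hx, hx'⟩)
    · exact hm
    · exact absurd hx.1 hx'
    · by_contra hxB
      exact hx' (Or.inr ⟨hx, hxB⟩)
  refine hGV n _ ⟨⟨hfin, _, ⟨m, rfl⟩, ?_⟩, Set.disjoint_left.1 hUV hAU⟩ (Or.inl rfl)
  rintro x (⟨hx | hx, hx'⟩ | ⟨hx, hx'⟩)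
  · exact absurd hx hx'
  · exact hx.1
  · exact absurd (Or.inl hx) hx'
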